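/- arXiv:1808.03239 — 2 statements merged into one kernel-verified Lean document; each statement's English description precedes it below -/
import Mathlib

section
/- Fix 0 < δ < 1/20. There exist constants 0 < a₁, A₁ < ∞ and σ₀ > 0 such that for all 0 < σ < σ₀ and every integer T > A₁·σ^{−a₁}: sup over x, y ∈ (−σ^{−11}, −δ) of ‖K̂_σ^T(x,·) − K̂_σ^T(y,·)‖_TV ≤ A₁·e^{−a₁/σ}, where K̂_σ^T denotes the T-fold iterate (composition) of the kernel K̂_σ. -/
open MeasureTheory Filter Set

/-- Gaussian density `φ_σ` with mean 0 and variance `σ²`. -/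
noncomputable def gaussDensity (σ x : ℝ) : ℝ :=
  (Real.sqrt (2 * Real.pi * σ ^ 2))⁻¹ * Real.exp (-(x ^ 2) / (2 * σ ^ 2))

/-- Density `f_σ` of the mixture `½ N(-1,σ²) + ½ N(1,σ²)`. -/
noncomputable def mixDensity (σ x : ℝ) : ℝ :=
  (1 / 2) * gaussDensity σ (x + 1) + (1 / 2) * gaussDensity σ (x - 1)

/-- The `N(0,σ²)` measure, defined via its density `φ_σ` w.r.t. Lebesgue measure. -/
noncomputable def gaussMeasure (σ : ℝ) : Measure ℝ :=
  volume.withDensity fun z => ENNReal.ofReal (gaussDensity σ z)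

/-- The random-walk Metropolis kernel `K_σ(x, ·)` as a measure: the accepted-move part
has density `min(1, f_σ(y)/f_σ(x))` w.r.t. the proposal `x + N(0,σ²)`, and the
remaining mass `1 − ∫ min(1, f_σ(x+z)/f_σ(x)) φ_σ(z) dz` stays at `x`. -/
noncomputable def rwmKernel (σ : ℝ) (x : ℝ) : Measure ℝ :=
  ((gaussMeasure σ).map (fun z => x + z)).withDensity
      (fun y => ENNReal.ofReal (min 1 (mixDensity σ y / mixDensity σ x)))
  + (ENNReal.ofReal
      (1 - ∫ z, min 1 (mixDensity σ (x + z) / mixDensity σ x) * gaussDensity σ z))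
      • Measure.dirac x

/-- The restricted Metropolis–Hastings kernel `K̂_σ` on `(-∞,0)`:
`K̂_σ(x,A) = K_σ(x, A ∩ (-∞,0)) + 1_A(x) K_σ(x,[0,∞))`. -/
noncomputable def rwmKernelHat (σ : ℝ) (x : ℝ) : Measure ℝ :=
  (rwmKernel σ x).restrict (Set.Iio 0) + (rwmKernel σ x (Set.Ici 0)) • Measure.dirac x

/-- `n`-step iterate of a (measure-valued) transition kernel. -/
noncomputable def kiter {α : Type*} [MeasurableSpace α] (κ : α → Measure α) :
    ℕ → α → Measure α
  | 0 => fun x => Measure.dirac x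
  | n + 1 => fun x => (kiter κ n x).bind κ

/-- A function on `S` whose oscillation is controlled by `W` admits a centering constant. -/
theorem exists_center {α : Type*} {S : Set α} {f W : α → ℝ}
    (h : ∀ x ∈ S, ∀ y ∈ S, |f x - f y| ≤ W x + W y) : ∃ c, ∀ x ∈ S, |f x - c| ≤ W x := by
  rcases S.eq_empty_or_nonempty with rfl | ⟨x₀, hx₀⟩
  · exact ⟨0, by simp⟩
  have hle : ∀ x ∈ S, ∀ y ∈ S, f x - W x ≤ f y + W y := fun x hx y hy => by
    linarith [(abs_le.1 (h x hx y hy)).2]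
  have hbdd : BddAbove ((fun x => f x - W x) '' S) :=
    ⟨f x₀ + W x₀, by rintro _ ⟨x, hx, rfl⟩; exact hle x hx x₀ hx₀⟩
  refine ⟨sSup ((fun x => f x - W x) '' S), fun x hx => abs_le.2 ⟨?_, ?_⟩⟩
  · have : sSup ((fun x => f x - W x) '' S) ≤ f x + W x :=
      csSup_le ⟨_, x₀, hx₀, rfl⟩ (by rintro _ ⟨y, hy, rfl⟩; exact hle y hy x hx)
    linarith
  · have := le_csSup hbdd ⟨x, hx, rfl⟩
    simp only at this
    linarith

section Iterate

variable {α : Type*} [MeasurableSpace α] {κ : α → Measure α}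

theorem measurable_kiter (hκ : Measurable κ) (n : ℕ) : Measurable (kiter κ n) := by
  induction n with
  | zero => exact Measure.measurable_dirac
  | succ n ih => exact (Measure.measurable_bind' hκ).comp ih

theorem kiter_succ_eq_bind (hκ : Measurable κ) (n : ℕ) (x : α) :
    kiter κ (n + 1) x = (κ x).bind (kiter κ n) := by
  induction n with
  | zero =>
    change (Measure.dirac x).bind κ = (κ x).bind Measure.dirac
    rw [Measure.dirac_bind hκ, Measure.bind_dirac]
  | succ n ih =>
    change (kiter κ (n + 1) x).bind κ = (κ x).bind fun y => (kiter κ n y).bind κ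
    rw [ih, Measure.bind_bind (measurable_kiter hκ n).aemeasurable hκ.aemeasurable]

theorem isProbabilityMeasure_kiter (hκ : Measurable κ) [hp : ∀ x, IsProbabilityMeasure (κ x)]
    (n : ℕ) (x : α) : IsProbabilityMeasure (kiter κ n x) := by
  induction n with
  | zero => exact Measure.dirac.isProbabilityMeasure
  | succ n ih =>
    refine ⟨?_⟩
    change (kiter κ n x).bind κ univ = 1
    rw [Measure.bind_apply MeasurableSet.univ hκ.aemeasurable]
    simp

theorem toReal_kiter_succ (hκ : Measurable κ) [∀ x, IsProbabilityMeasure (κ x)]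
    (n : ℕ) (x : α) {B : Set α} (hB : MeasurableSet B) :
    (kiter κ (n + 1) x B).toReal = ∫ y, (kiter κ n y B).toReal ∂κ x := by
  have := isProbabilityMeasure_kiter hκ n
  rw [kiter_succ_eq_bind hκ, Measure.bind_apply hB (measurable_kiter hκ n).aemeasurable,
    integral_toReal]
  · exact ((Measure.measurable_coe hB).comp (measurable_kiter hκ n)).aemeasurable
  · exact ae_of_all _ fun y => measure_lt_top _ _

end Iterate

section Harris

variable {α : Type*} [MeasurableSpace α]

theorem abs_integral_le_of_ae_mem {S : Set α} {μ : Measure α} [IsFiniteMeasure μ]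
    (hS : ∀ᵐ x ∂μ, x ∈ S) {g V : α → ℝ} (hV : Integrable V μ) {L β : ℝ}
    (hg : ∀ x ∈ S, |g x| ≤ L * (1 + β * V x)) :
    |∫ x, g x ∂μ| ≤ L * (μ.real univ + β * ∫ x, V x ∂μ) := by
  have hi : Integrable (fun x => L * (1 + β * V x)) μ :=
    ((integrable_const 1).add (hV.const_mul β)).const_mul L
  have := norm_integral_le_of_norm_le (f := g) hi (hS.mono fun x hx => hg x hx)
  rw [integral_const_mul, integral_add (integrable_const 1) (hV.const_mul β),
    integral_const_mul, integral_const] at this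
  simpa using this

/-- Contraction of a weighted oscillation seminorm under a drift condition and a minorization
condition on a sublevel set of the Lyapunov function; the constants depend only on those of
the two conditions. -/
theorem exists_contraction {γ K ε : ℝ} (hγ0 : 0 < γ) (hγ1 : γ < 1) (hK : 0 < K)
    (hε0 : 0 < ε) :
    ∃ a β : ℝ, 0 < a ∧ a < 1 ∧ 0 < β ∧ ∀ (κ : α → Measure α) (S : Set α) (V : α → ℝ)
      (ν : Measure α), (∀ x, IsProbabilityMeasure (κ x)) → (∀ x ∈ S, ∀ᵐ y ∂κ x, y ∈ S) →
      (∀ x, 0 ≤ V x) → (∀ x ∈ S, Integrable V (κ x)) →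
      (∀ x ∈ S, ∫ y, V y ∂κ x ≤ γ * V x + K) → ε ≤ ν.real univ → IsFiniteMeasure ν →
      (∀ x ∈ S, V x ≤ 4 * K / (1 - γ) → ν ≤ κ x) →
      ∀ (f : α → ℝ) (L : ℝ), 0 ≤ L → Measurable f → (∀ x, |f x| ≤ 1) →
      (∀ x ∈ S, ∀ y ∈ S, |f x - f y| ≤ L * (2 + β * (V x + V y))) →
      ∀ x ∈ S, ∀ y ∈ S, |∫ u, f u ∂κ x - ∫ u, f u ∂κ y| ≤ a * L * (2 + β * (V x + V y)) := by
  set R := 4 * K / (1 - γ) with hR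
  have h1γ : 0 < 1 - γ := by linarith
  have hR0 : 0 < R := by positivity
  have hRK : R * (1 - γ) = 4 * K := by rw [hR]; field_simp
  set β := ε / (2 * K) with hβ
  have hβ0 : 0 < β := by positivity
  have hβK : 2 * (β * K) = ε := by rw [hβ]; field_simp
  set θ := (1 + γ) / 2 with hθ
  set a₁ := (2 + β * R * θ) / (2 + β * R) with ha₁
  have hβR : 0 < β * R := by positivity
  have ha₁1 : a₁ < 1 := by
    rw [ha₁, div_lt_one (by positivity)]
    nlinarith
  have ha₁eq : a₁ * (2 + β * R) = 2 + β * R * θ := by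
    rw [ha₁]; field_simp
  have hθa₁ : θ ≤ a₁ := by
    rw [ha₁, le_div_iff₀ (by positivity)]
    nlinarith
  refine ⟨max a₁ (max (1 - ε / 2) γ), β, ?_, ?_, hβ0, ?_⟩
  · exact lt_max_of_lt_right (lt_max_of_lt_right hγ0)
  · exact max_lt ha₁1 (max_lt (by linarith) hγ1)
  intro κ S V ν hprob hS hV0 hVi hdrift hν hνf hmin f L hL hf hf1 hosc x hx y hy
  set a := max a₁ (max (1 - ε / 2) γ) with ha
  have h1 : a₁ ≤ a := le_max_left _ _
  have h2 : 1 - ε / 2 ≤ a := (le_max_left _ _).trans (le_max_right _ _)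
  have h3 : γ ≤ a := (le_max_right _ _).trans (le_max_right _ _)
  obtain ⟨c, hc⟩ := exists_center (S := S) (f := f) (W := fun x => L * (1 + β * V x))
    (fun x hx y hy => (hosc x hx y hy).trans (le_of_eq (by ring)))
  have hfi : ∀ (μ : Measure α) [IsFiniteMeasure μ], Integrable f μ := fun μ _ =>
    (integrable_const (1 : ℝ)).mono' hf.aestronglyMeasurable (ae_of_all _ hf1)
  have hfci : ∀ (μ : Measure α) [IsFiniteMeasure μ], Integrable (fun u => f u - c) μ :=
    fun μ _ => (hfi μ).sub (integrable_const c)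
  have hcenter : ∀ z, ∫ u, f u ∂κ z = ∫ u, (f u - c) ∂κ z + c := fun z => by
    rw [integral_sub (hfi _) (integrable_const c)]; simp
  have hdx := hdrift x hx
  have hdy := hdrift y hy
  have hVx := hV0 x
  have hVy := hV0 y
  rw [mul_comm a L, mul_assoc]
  rcases le_total R (V x + V y) with hcase | hcase
  · have bx := abs_integral_le_of_ae_mem (hS x hx) (hVi x hx) hc
    have bY := abs_integral_le_of_ae_mem (hS y hy) (hVi y hy) hc
    rw [hcenter x, hcenter y, add_sub_add_right_eq_sub]
    refine (abs_sub _ _).trans ((add_le_add bx bY).trans ?_)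
    rw [← mul_add]
    refine mul_le_mul_of_nonneg_left ?_ hL
    simp only [probReal_univ]
    have e1 : β * ∫ u, V u ∂κ x ≤ β * (γ * V x + K) := by gcongr
    have e2 : β * ∫ u, V u ∂κ y ≤ β * (γ * V y + K) := by gcongr
    have e3 : 4 * K ≤ (V x + V y) * (1 - γ) := by rw [← hRK]; gcongr
    have e4 : β * (4 * K) ≤ β * ((V x + V y) * (1 - γ)) := by gcongr
    have e5 : a₁ * (2 + β * (V x + V y)) ≤ a * (2 + β * (V x + V y)) := by gcongr
    have e6 : 0 ≤ (a₁ - θ) * (β * (V x + V y - R)) :=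
      mul_nonneg (by linarith) (mul_nonneg hβ0.le (by linarith))
    rw [hθ] at *
    nlinarith
  · have key : ∀ z ∈ S, V z ≤ R → ∃ I, ∫ u, f u ∂κ z = (∫ u, (f u - c) ∂ν + c) + I ∧
        |I| ≤ L * (1 - ε + β * (γ * V z + K)) := by
      intro z hz hzR
      have hle := hmin z hz hzR
      have hsub : κ z - ν + ν = κ z := Measure.sub_add_cancel_of_le hle
      have hle' : κ z - ν ≤ κ z := Measure.sub_le
      refine ⟨∫ u, (f u - c) ∂(κ z - ν), ?_, ?_⟩
      · rw [hcenter z]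
        conv_lhs => rw [← hsub]
        rw [integral_add_measure (hfci _) (hfci _)]
        ring
      · have b := abs_integral_le_of_ae_mem (μ := κ z - ν)
          (Measure.absolutelyContinuous_of_le hle' |>.ae_le (hS z hz))
          ((hVi z hz).mono_measure hle') hc
        refine b.trans (mul_le_mul_of_nonneg_left ?_ hL)
        have m1 : (κ z - ν).real univ + ν.real univ = 1 := by
          rw [← measureReal_add_apply, hsub, probReal_univ]
        have m2 : ∫ u, V u ∂(κ z - ν) ≤ ∫ u, V u ∂κ z :=
          integral_mono_measure hle' (ae_of_all _ hV0) (hVi z hz)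
        have m3 : β * ∫ u, V u ∂(κ z - ν) ≤ β * (γ * V z + K) :=
          mul_le_mul_of_nonneg_left (m2.trans (hdrift z hz)) hβ0.le
        linarith
    obtain ⟨I, hI, bI⟩ := key x hx (by linarith)
    obtain ⟨J, hJ, bJ⟩ := key y hy (by linarith)
    rw [hI, hJ, add_sub_add_left_eq_sub]
    refine (abs_sub _ _).trans ((add_le_add bI bJ).trans ?_)
    rw [← mul_add]
    refine mul_le_mul_of_nonneg_left ?_ hL
    have e1 : γ * (β * (V x + V y)) ≤ a * (β * (V x + V y)) := by gcongr
    nlinarith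

theorem abs_sub_kiter_le {κ : α → Measure α} (hκ : Measurable κ)
    [∀ x, IsProbabilityMeasure (κ x)] {S : Set α} {V : α → ℝ} (hV : ∀ x, 0 ≤ V x)
    {a β : ℝ} (ha : 0 ≤ a) (hβ : 0 ≤ β)
    (h : ∀ (f : α → ℝ) (L : ℝ), 0 ≤ L → Measurable f → (∀ x, |f x| ≤ 1) →
      (∀ x ∈ S, ∀ y ∈ S, |f x - f y| ≤ L * (2 + β * (V x + V y))) →
      ∀ x ∈ S, ∀ y ∈ S, |∫ u, f u ∂κ x - ∫ u, f u ∂κ y| ≤ a * L * (2 + β * (V x + V y)))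
    {B : Set α} (hB : MeasurableSet B) (n : ℕ) :
    ∀ x ∈ S, ∀ y ∈ S, |(kiter κ n x B).toReal - (kiter κ n y B).toReal|
      ≤ a ^ n * (2 + β * (V x + V y)) := by
  have hbd : ∀ n x, |(kiter κ n x B).toReal| ≤ 1 := fun n x => by
    have := isProbabilityMeasure_kiter hκ n x
    rw [abs_of_nonneg ENNReal.toReal_nonneg]
    exact measureReal_le_one
  induction n with
  | zero =>
    intro x _ y _
    have h1 := hbd 0 x
    have h2 := hbd 0 y
    have h3 : 0 ≤ β * (V x + V y) := mul_nonneg hβ (add_nonneg (hV x) (hV y))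
    rw [pow_zero, one_mul]
    exact (abs_sub _ _).trans (by linarith)
  | succ n ih =>
    intro x hx y hy
    rw [toReal_kiter_succ hκ n x hB, toReal_kiter_succ hκ n y hB, pow_succ']
    exact h _ _ (pow_nonneg ha n)
      ((Measure.measurable_coe hB).comp (measurable_kiter hκ n)).ennreal_toReal
      (hbd n) ih x hx y hy

end Harris

section Densities

theorem gaussDensity_eq_gaussianPDFReal (σ : ℝ) :
    gaussDensity σ = ProbabilityTheory.gaussianPDFReal 0 ⟨σ ^ 2, sq_nonneg σ⟩ := by
  ext x
  simp only [gaussDensity, ProbabilityTheory.gaussianPDFReal, sub_zero]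
  rfl

theorem gaussDensity_eq {σ : ℝ} (hσ : 0 < σ) (x : ℝ) :
    gaussDensity σ x = (Real.sqrt (2 * Real.pi))⁻¹ * σ⁻¹ * Real.exp (-(x / σ) ^ 2 / 2) := by
  rw [gaussDensity, Real.sqrt_mul (by positivity), Real.sqrt_sq hσ.le, mul_inv]
  congr 2
  field_simp

theorem gaussDensity_pos {σ : ℝ} (hσ : 0 < σ) (x : ℝ) : 0 < gaussDensity σ x := by
  rw [gaussDensity_eq hσ]
  have := Real.pi_pos
  positivity

theorem gaussDensity_nonneg (σ x : ℝ) : 0 ≤ gaussDensity σ x := by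
  unfold gaussDensity
  positivity

@[fun_prop]
theorem continuous_gaussDensity (σ : ℝ) : Continuous (gaussDensity σ) := by
  unfold gaussDensity
  fun_prop

@[fun_prop]
theorem measurable_gaussDensity (σ : ℝ) : Measurable (gaussDensity σ) :=
  (continuous_gaussDensity σ).measurable

theorem integrable_gaussDensity (σ : ℝ) : Integrable (gaussDensity σ) := by
  rw [gaussDensity_eq_gaussianPDFReal]
  exact ProbabilityTheory.integrable_gaussianPDFReal _ _

theorem integral_gaussDensity {σ : ℝ} (hσ : 0 < σ) : ∫ x, gaussDensity σ x = 1 := by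
  rw [gaussDensity_eq_gaussianPDFReal]
  refine ProbabilityTheory.integral_gaussianPDFReal_eq_one _ fun h => ?_
  have : σ ^ 2 = 0 := congrArg NNReal.toReal h
  exact hσ.ne' (by simpa using this)

theorem mixDensity_pos {σ : ℝ} (hσ : 0 < σ) (x : ℝ) : 0 < mixDensity σ x := by
  have h1 := gaussDensity_pos hσ (x + 1)
  have h2 := gaussDensity_pos hσ (x - 1)
  unfold mixDensity
  positivity

@[fun_prop]
theorem measurable_mixDensity (σ : ℝ) : Measurable (mixDensity σ) := by
  unfold mixDensity
  fun_prop

theorem half_gaussDensity_le_mixDensity (σ x : ℝ) :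
    gaussDensity σ (x + 1) / 2 ≤ mixDensity σ x := by
  have := gaussDensity_nonneg σ (x - 1)
  unfold mixDensity
  linarith

theorem mixDensity_le_gaussDensity {σ x : ℝ} (hx : x ≤ 0) :
    mixDensity σ x ≤ gaussDensity σ (x + 1) := by
  have : gaussDensity σ (x - 1) ≤ gaussDensity σ (x + 1) := by
    unfold gaussDensity
    gcongr ?_ * Real.exp (?_ / _)
    nlinarith
  unfold mixDensity
  linarith

theorem gaussDensity_div {σ : ℝ} (hσ : 0 < σ) (x y : ℝ) :
    gaussDensity σ y / gaussDensity σ x = Real.exp (((x / σ) ^ 2 - (y / σ) ^ 2) / 2) := by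
  have := Real.pi_pos
  rw [gaussDensity_eq hσ, gaussDensity_eq hσ, mul_div_mul_left _ _ (by positivity), ← Real.exp_sub]
  congr 1
  ring

/-- The Metropolis acceptance probability of a move from `x` to `y`. -/
noncomputable def acceptProb (σ x y : ℝ) : ℝ := min 1 (mixDensity σ y / mixDensity σ x)

theorem acceptProb_le_one (σ x y : ℝ) : acceptProb σ x y ≤ 1 := min_le_left _ _

theorem acceptProb_nonneg {σ : ℝ} (hσ : 0 < σ) (x y : ℝ) : 0 ≤ acceptProb σ x y :=
  le_min zero_le_one (div_nonneg (mixDensity_pos hσ y).le (mixDensity_pos hσ x).le)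

@[fun_prop]
theorem measurable_acceptProb (σ : ℝ) : Measurable fun p : ℝ × ℝ => acceptProb σ p.1 p.2 := by
  unfold acceptProb
  fun_prop

theorem acceptProb_le {σ : ℝ} (hσ : 0 < σ) (x : ℝ) {y : ℝ} (hy : y ≤ 0) :
    acceptProb σ x y ≤ 2 * Real.exp ((((x + 1) / σ) ^ 2 - ((y + 1) / σ) ^ 2) / 2) := by
  have hg := gaussDensity_pos hσ (x + 1)
  calc acceptProb σ x y ≤ mixDensity σ y / mixDensity σ x := min_le_right _ _
    _ ≤ gaussDensity σ (y + 1) / (gaussDensity σ (x + 1) / 2) :=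
      div_le_div₀ (gaussDensity_nonneg _ _) (mixDensity_le_gaussDensity hy) (by positivity)
        (half_gaussDensity_le_mixDensity σ x)
    _ = _ := by rw [← gaussDensity_div hσ]; field_simp

theorem le_acceptProb {σ : ℝ} (hσ : 0 < σ) {x : ℝ} (hx : x ≤ 0) (y : ℝ) :
    min 1 (Real.exp ((((x + 1) / σ) ^ 2 - ((y + 1) / σ) ^ 2) / 2) / 2) ≤ acceptProb σ x y := by
  refine min_le_min_left _ ?_
  calc _ = (gaussDensity σ (y + 1) / 2) / gaussDensity σ (x + 1) := by
        rw [← gaussDensity_div hσ]; ring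
    _ ≤ _ := div_le_div₀ (mixDensity_pos hσ y).le (half_gaussDensity_le_mixDensity σ y)
        (mixDensity_pos hσ x) (mixDensity_le_gaussDensity hx)

/-- The density at `y` of the accepted part of a move from `x`. -/
noncomputable def moveDensity (σ x y : ℝ) : ℝ := acceptProb σ x y * gaussDensity σ (y - x)

theorem moveDensity_nonneg {σ : ℝ} (hσ : 0 < σ) (x y : ℝ) : 0 ≤ moveDensity σ x y :=
  mul_nonneg (acceptProb_nonneg hσ x y) (gaussDensity_nonneg _ _)

theorem moveDensity_le (σ x y : ℝ) : moveDensity σ x y ≤ gaussDensity σ (y - x) :=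
  mul_le_of_le_one_left (gaussDensity_nonneg _ _) (acceptProb_le_one σ x y)

@[fun_prop]
theorem measurable_moveDensity (σ : ℝ) : Measurable fun p : ℝ × ℝ => moveDensity σ p.1 p.2 := by
  unfold moveDensity
  fun_prop

theorem measurable_moveDensity_right (σ x : ℝ) : Measurable (moveDensity σ x) := by
  unfold moveDensity acceptProb
  fun_prop

theorem integrable_moveDensity {σ : ℝ} (hσ : 0 < σ) (x : ℝ) : Integrable (moveDensity σ x) :=
  ((integrable_gaussDensity σ).comp_sub_right x).mono'
    (measurable_moveDensity_right σ x).aestronglyMeasurable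
    (ae_of_all _ fun y => by
      rw [Real.norm_of_nonneg (moveDensity_nonneg hσ x y)]; exact moveDensity_le σ x y)

theorem integral_moveDensity_le_one {σ : ℝ} (hσ : 0 < σ) (x : ℝ) :
    ∫ y, moveDensity σ x y ≤ 1 := by
  refine (integral_mono (integrable_moveDensity hσ x)
    ((integrable_gaussDensity σ).comp_sub_right x) (moveDensity_le σ x)).trans_eq ?_
  rw [integral_sub_right_eq_self (gaussDensity σ) x, integral_gaussDensity hσ]

end Densities

section Kernel

theorem map_gaussMeasure_add_left (σ x : ℝ) :
    (gaussMeasure σ).map (fun z => x + z) =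
      volume.withDensity fun y => ENNReal.ofReal (gaussDensity σ (y - x)) := by
  ext B hB
  rw [Measure.map_apply (by fun_prop) hB, gaussMeasure,
    withDensity_apply _ (hB.preimage (by fun_prop)), withDensity_apply _ hB,
    ← lintegral_indicator hB, ← lintegral_indicator (hB.preimage (by fun_prop)),
    ← lintegral_add_left_eq_self (B.indicator fun y => ENNReal.ofReal (gaussDensity σ (y - x))) x]
  refine lintegral_congr fun z => ?_
  by_cases hz : x + z ∈ B <;> simp [hz]

theorem rwmKernel_eq {σ : ℝ} (hσ : 0 < σ) (x : ℝ) :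
    rwmKernel σ x = volume.withDensity (fun y => ENNReal.ofReal (moveDensity σ x y)) +
      ENNReal.ofReal (1 - ∫ y, moveDensity σ x y) • Measure.dirac x := by
  have h : ∫ z, min 1 (mixDensity σ (x + z) / mixDensity σ x) * gaussDensity σ z =
      ∫ y, moveDensity σ x y := by
    rw [← integral_add_left_eq_self (moveDensity σ x) x]
    simp [moveDensity, acceptProb]
  rw [rwmKernel, map_gaussMeasure_add_left, h, ← withDensity_mul _ (by fun_prop) (by fun_prop)]
  congr 2
  ext y
  rw [moveDensity, ENNReal.ofReal_mul (acceptProb_nonneg hσ x y), Pi.mul_apply, mul_comm]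
  rfl

theorem isProbabilityMeasure_rwmKernel {σ : ℝ} (hσ : 0 < σ) (x : ℝ) :
    IsProbabilityMeasure (rwmKernel σ x) := by
  refine ⟨?_⟩
  rw [rwmKernel_eq hσ, Measure.add_apply, withDensity_apply _ MeasurableSet.univ, setLIntegral_univ,
    ← ofReal_integral_eq_lintegral_ofReal (integrable_moveDensity hσ x)
      (ae_of_all _ (moveDensity_nonneg hσ x)), Measure.smul_apply, measure_univ, smul_eq_mul,
    mul_one, ← ENNReal.ofReal_add (integral_nonneg (moveDensity_nonneg hσ x))
      (sub_nonneg.2 (integral_moveDensity_le_one hσ x))]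
  simp

theorem isProbabilityMeasure_rwmKernelHat {σ : ℝ} (hσ : 0 < σ) (x : ℝ) :
    IsProbabilityMeasure (rwmKernelHat σ x) := by
  have := isProbabilityMeasure_rwmKernel hσ x
  refine ⟨?_⟩
  rw [rwmKernelHat, Measure.add_apply, Measure.restrict_apply_univ, Measure.smul_apply,
    measure_univ, smul_eq_mul, mul_one, ← compl_Iio, measure_add_measure_compl measurableSet_Iio,
    measure_univ]

theorem measurable_rwmKernel {σ : ℝ} (hσ : 0 < σ) : Measurable (rwmKernel σ) := by
  refine Measure.measurable_of_measurable_coe _ fun B hB => ?_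
  simp_rw [rwmKernel_eq hσ, Measure.add_apply, Measure.smul_apply, withDensity_apply _ hB,
    smul_eq_mul]
  have h : Measurable fun x => ∫ y, moveDensity σ x y :=
    (measurable_moveDensity σ).stronglyMeasurable.integral_prod_right.measurable
  refine Measurable.add ?_ ?_
  · exact (measurable_moveDensity σ).ennreal_ofReal.lintegral_prod_right'
  · exact (measurable_const.sub h).ennreal_ofReal.mul
      ((Measure.measurable_coe hB).comp Measure.measurable_dirac)

theorem measurable_rwmKernelHat {σ : ℝ} (hσ : 0 < σ) : Measurable (rwmKernelHat σ) := by
  refine Measure.measurable_of_measurable_coe _ fun B hB => ?_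
  simp_rw [rwmKernelHat, Measure.add_apply, Measure.smul_apply, Measure.restrict_apply hB,
    smul_eq_mul]
  have h := measurable_rwmKernel hσ
  exact ((Measure.measurable_coe (hB.inter measurableSet_Iio)).comp h).add
    (((Measure.measurable_coe measurableSet_Ici).comp h).mul
      ((Measure.measurable_coe hB).comp Measure.measurable_dirac))

theorem exists_rwmKernelHat_eq {σ : ℝ} (hσ : 0 < σ) {x : ℝ} (hx : x < 0) :
    ∃ c : ENNReal, c ≠ ⊤ ∧ rwmKernelHat σ x =
      volume.withDensity ((Iio 0).indicator fun y => ENNReal.ofReal (moveDensity σ x y)) +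
        c • Measure.dirac x := by
  classical
  have := isProbabilityMeasure_rwmKernel hσ x
  refine ⟨ENNReal.ofReal (1 - ∫ y, moveDensity σ x y) + rwmKernel σ x (Ici 0),
    ENNReal.add_ne_top.2 ⟨ENNReal.ofReal_ne_top, measure_ne_top _ _⟩, ?_⟩
  rw [rwmKernelHat, withDensity_indicator measurableSet_Iio, add_smul, ← add_assoc]
  congr 1
  rw [rwmKernel_eq hσ, Measure.restrict_add, Measure.restrict_smul,
    restrict_withDensity measurableSet_Iio, restrict_dirac' measurableSet_Iio,
    if_pos (mem_Iio.2 hx)]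

theorem ae_rwmKernelHat_neg (σ : ℝ) {x : ℝ} (hx : x < 0) : ∀ᵐ y ∂rwmKernelHat σ x, y < 0 := by
  rw [rwmKernelHat, ae_add_measure_iff]
  refine ⟨ae_restrict_mem measurableSet_Iio, Measure.ae_smul_measure ?_ _⟩
  rw [ae_dirac_iff measurableSet_Iio]
  exact hx

/-- The integral of `V` against the restricted kernel is `V x` plus the contribution of the
accepted moves. -/
theorem integrable_rwmKernelHat_and_integral_sub {σ : ℝ} (hσ : 0 < σ) {x : ℝ} (hx : x < 0)
    {V : ℝ → ℝ} (hV : Measurable V) {C : ℝ}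
    (hC : ∀ y < 0, acceptProb σ x y * |V y - V x| ≤ C) :
    Integrable V (rwmKernelHat σ x) ∧
      Integrable ((Iio 0).indicator fun y => moveDensity σ x y * (V y - V x)) ∧
      ∫ y, V y ∂rwmKernelHat σ x =
        V x + ∫ y, (Iio 0).indicator (fun y => moveDensity σ x y * (V y - V x)) y := by
  have := isProbabilityMeasure_rwmKernelHat hσ x
  obtain ⟨c, hc, hP⟩ := exists_rwmKernelHat_eq hσ hx
  have hmeas : Measurable ((Iio (0 : ℝ)).indicator
      fun y => ENNReal.ofReal (moveDensity σ x y)) :=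
    (measurable_moveDensity_right σ x).ennreal_ofReal.indicator measurableSet_Iio
  have hlt : ∀ᵐ y, (Iio (0 : ℝ)).indicator
      (fun y => ENNReal.ofReal (moveDensity σ x y)) y < ⊤ := ae_of_all _ fun y => by
    by_cases hy : y ∈ Iio (0 : ℝ) <;> simp [hy]
  have hsmul : (fun y => ((Iio (0 : ℝ)).indicator
      (fun y => ENNReal.ofReal (moveDensity σ x y)) y).toReal • (V y - V x)) =
      (Iio 0).indicator fun y => moveDensity σ x y * (V y - V x) := by
    ext y
    by_cases hy : y ∈ Iio (0 : ℝ) <;>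
      simp [hy, ENNReal.toReal_ofReal (moveDensity_nonneg hσ x y)]
  have hint : Integrable ((Iio 0).indicator fun y => moveDensity σ x y * (V y - V x)) := by
    refine (((integrable_gaussDensity σ).comp_sub_right x).const_mul C).mono'
      (((measurable_moveDensity_right σ x).mul
        (hV.sub_const _)).indicator measurableSet_Iio).aestronglyMeasurable
      (ae_of_all _ fun y => ?_)
    have hg := gaussDensity_nonneg σ (y - x)
    have hC0 : 0 ≤ C := le_trans (by simp) (hC x hx)
    by_cases hy : y ∈ Iio (0 : ℝ)
    · rw [indicator_of_mem hy, norm_mul, Real.norm_of_nonneg (moveDensity_nonneg hσ x y),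
        moveDensity, mul_right_comm]
      exact mul_le_mul_of_nonneg_right (hC y hy) hg
    · rw [indicator_of_notMem hy, norm_zero]
      positivity
  have hintW : Integrable (fun y => V y - V x) (volume.withDensity
      ((Iio 0).indicator fun y => ENNReal.ofReal (moveDensity σ x y))) := by
    rw [integrable_withDensity_iff_integrable_smul' hmeas hlt, hsmul]
    exact hint
  have hintD : Integrable (fun y => V y - V x) (c • Measure.dirac x) :=
    (integrable_dirac (by simp)).smul_measure hc
  have hsub : Integrable (fun y => V y - V x) (rwmKernelHat σ x) := by
    rw [hP]
    exact hintW.add_measure hintD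
  have hVi : Integrable V (rwmKernelHat σ x) := by
    simpa [Pi.add_def] using hsub.add (integrable_const (V x))
  refine ⟨hVi, hint, ?_⟩
  have h1 : ∫ y, (V y - V x) ∂rwmKernelHat σ x = ∫ y, V y ∂rwmKernelHat σ x - V x := by
    rw [integral_sub hVi (integrable_const _)]; simp
  rw [← sub_eq_iff_eq_add', ← h1, hP, integral_add_measure hintW hintD, integral_smul_measure,
    integral_dirac, sub_self, smul_zero, add_zero,
    integral_withDensity_eq_integral_toReal_smul hmeas hlt, hsmul]

end Kernel

section Bounds

/-- Increment of `exp |u|` weighted by an acceptance probability for a Gaussian-like target. -/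
theorem mul_exp_abs_sub_le_four {u v p : ℝ} (hp0 : 0 ≤ p) (hp1 : p ≤ 1)
    (hp : p ≤ 2 * Real.exp ((u ^ 2 - v ^ 2) / 2)) :
    p * |Real.exp (|v|) - Real.exp (|u|)| ≤ 4 * Real.exp |u| := by
  have hu := Real.exp_pos |u|
  have hv := Real.exp_pos |v|
  rcases le_total |v| |u| with h | h
  · have := Real.exp_le_exp.2 h
    rw [abs_of_nonpos (by linarith)]
    nlinarith
  · have := Real.exp_le_exp.2 h
    rw [abs_of_nonneg (by linarith)]
    have h1 : (u ^ 2 - v ^ 2) / 2 + |v| ≤ 1 / 2 + |u| := by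
      rw [← sq_abs u, ← sq_abs v]
      nlinarith [sq_nonneg (|v| - |u| - 1), abs_nonneg u]
    have h2 : Real.exp (1 / 2) ≤ 2 := by
      have h3 : Real.exp (1 / 2) ^ 2 = Real.exp 1 := by rw [← Real.exp_nat_mul]; norm_num
      have h4 := Real.exp_one_lt_d9
      nlinarith [Real.exp_pos (1 / 2)]
    calc p * (Real.exp |v| - Real.exp |u|) ≤ p * Real.exp |v| := by nlinarith
      _ ≤ 2 * Real.exp ((u ^ 2 - v ^ 2) / 2) * Real.exp |v| := by gcongr
      _ = 2 * Real.exp ((u ^ 2 - v ^ 2) / 2 + |v|) := by rw [Real.exp_add]; ring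
      _ ≤ 2 * Real.exp (1 / 2 + |u|) := by gcongr
      _ ≤ 4 * Real.exp |u| := by rw [Real.exp_add]; nlinarith

theorem mul_exp_abs_sub_le_of_large {u v p : ℝ} (hu : 1 < |u|) (hp0 : 0 ≤ p)
    (hp : p ≤ 2 * Real.exp ((u ^ 2 - v ^ 2) / 2)) :
    p * (Real.exp |v| - Real.exp |u|) ≤ 2 / (|u| - 1) * Real.exp |u| := by
  have hk : 0 < |u| - 1 := by linarith
  rcases le_total |v| |u| with h | h
  · have := Real.exp_le_exp.2 h
    exact (mul_nonpos_of_nonneg_of_nonpos hp0 (by linarith)).trans (by positivity)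
  set t := |v| - |u| with ht
  have ht0 : 0 ≤ t := by linarith
  have hv : |v| = |u| + t := by linarith
  have h1 : (u ^ 2 - v ^ 2) / 2 ≤ -(|u| * t) := by
    rw [← sq_abs u, ← sq_abs v, hv]; nlinarith
  have h2 : Real.exp t - 1 ≤ t * Real.exp t := by
    have h3 := Real.add_one_le_exp (-t)
    have h4 : Real.exp (-t) * Real.exp t = 1 := by rw [← Real.exp_add]; simp
    nlinarith [Real.exp_pos t]
  have h5 : t * Real.exp (-((|u| - 1) * t)) ≤ 1 / (|u| - 1) := by
    rw [Real.exp_neg, ← div_eq_mul_inv, div_le_div_iff₀ (Real.exp_pos _) hk]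
    nlinarith [Real.add_one_le_exp ((|u| - 1) * t)]
  have h6 : 0 ≤ Real.exp t - 1 := by linarith [Real.add_one_le_exp t]
  calc p * (Real.exp |v| - Real.exp |u|) = p * (Real.exp t - 1) * Real.exp |u| := by
        rw [hv, Real.exp_add]; ring
    _ ≤ 2 * Real.exp (-(|u| * t)) * (t * Real.exp t) * Real.exp |u| := by
        gcongr
        exact hp.trans (by gcongr)
    _ = 2 * (t * Real.exp (-((|u| - 1) * t))) * Real.exp |u| := by
        rw [show -((|u| - 1) * t) = -(|u| * t) + t by ring, Real.exp_add]; ring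
    _ ≤ 2 * (1 / (|u| - 1)) * Real.exp |u| := by gcongr
    _ = _ := by ring

theorem mul_exp_abs_sub_le_of_inward {u v p : ℝ} (huv : |v| ≤ |u| - 1) (hp : 1 / 2 ≤ p) :
    p * (Real.exp |v| - Real.exp |u|) ≤ -(3 / 10) * Real.exp |u| := by
  have h1 : Real.exp |v| ≤ Real.exp (-1) * Real.exp |u| := by
    rw [← Real.exp_add]
    exact Real.exp_le_exp.2 (by linarith)
  have h2 : Real.exp (-1) ≤ 2 / 5 := by
    linarith [Real.exp_neg_one_lt_d9]
  have h3 : Real.exp |v| - Real.exp |u| ≤ -(3 / 5) * Real.exp |u| := by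
    nlinarith [Real.exp_pos |u|]
  nlinarith [Real.exp_pos |u|]

end Bounds

section Lyapunov

/-- Lyapunov function for the restricted kernel. -/
noncomputable def lyapunov (σ x : ℝ) : ℝ := Real.exp |(x + 1) / σ|

theorem lyapunov_pos (σ x : ℝ) : 0 < lyapunov σ x := Real.exp_pos _

theorem measurable_lyapunov (σ : ℝ) : Measurable (lyapunov σ) := by
  unfold lyapunov
  fun_prop

theorem acceptProb_mul_abs_lyapunov_sub_le {σ : ℝ} (hσ : 0 < σ) (x : ℝ) {y : ℝ} (hy : y < 0) :
    acceptProb σ x y * |lyapunov σ y - lyapunov σ x| ≤ 4 * lyapunov σ x :=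
  mul_exp_abs_sub_le_four (acceptProb_nonneg hσ x y) (acceptProb_le_one σ x y)
    (acceptProb_le hσ x hy.le)

theorem integrable_lyapunov {σ x : ℝ} (hσ : 0 < σ) (hx : x < 0) :
    Integrable (lyapunov σ) (rwmKernelHat σ x) :=
  (integrable_rwmKernelHat_and_integral_sub hσ hx (measurable_lyapunov σ)
    fun _ hy => acceptProb_mul_abs_lyapunov_sub_le hσ x hy).1

theorem integral_lyapunov_le {σ x : ℝ} (hσ : 0 < σ) (hx : x < 0) {h : ℝ → ℝ}
    (hh : Integrable fun y => h y * gaussDensity σ (y - x)) (hh0 : ∀ y, 0 ≤ y → 0 ≤ h y)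
    (hle : ∀ y < 0, acceptProb σ x y * (lyapunov σ y - lyapunov σ x) ≤ h y * lyapunov σ x) :
    ∫ y, lyapunov σ y ∂rwmKernelHat σ x ≤
      (1 + ∫ y, h y * gaussDensity σ (y - x)) * lyapunov σ x := by
  obtain ⟨-, hi, he⟩ := integrable_rwmKernelHat_and_integral_sub hσ hx (measurable_lyapunov σ)
    fun _ hy => acceptProb_mul_abs_lyapunov_sub_le hσ x hy
  rw [he, add_mul, one_mul, ← integral_mul_const]
  refine add_le_add_right (integral_mono hi (hh.mul_const _) fun y => ?_) _
  have hg := gaussDensity_nonneg σ (y - x)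
  have hV := lyapunov_pos σ x
  by_cases hy : y < 0
  · rw [indicator_of_mem (mem_Iio.2 hy), moveDensity, mul_right_comm, mul_right_comm (h y)]
    exact mul_le_mul_of_nonneg_right (hle y hy) hg
  · rw [indicator_of_notMem (by simpa using hy)]
    have := hh0 y (not_lt.1 hy)
    positivity

theorem integral_lyapunov_le_five {σ x : ℝ} (hσ : 0 < σ) (hx : x < 0) :
    ∫ y, lyapunov σ y ∂rwmKernelHat σ x ≤ 5 * lyapunov σ x := by
  have h := integral_lyapunov_le hσ hx (h := fun _ => 4)
    (((integrable_gaussDensity σ).comp_sub_right x).const_mul 4) (fun _ _ => by norm_num)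
    fun y hy => (mul_le_mul_of_nonneg_left (le_abs_self _) (acceptProb_nonneg hσ x y)).trans
      (acceptProb_mul_abs_lyapunov_sub_le hσ x hy)
  rw [integral_const_mul, integral_sub_right_eq_self (gaussDensity σ) x,
    integral_gaussDensity hσ] at h
  linarith

theorem le_setIntegral_gaussDensity {σ x l : ℝ} (hσ : 0 < σ)
    (hl : ∀ y ∈ Icc l (l + σ), |y - x| ≤ 2 * σ) :
    1 / 27 ≤ ∫ y in Icc l (l + σ), gaussDensity σ (y - x) := by
  have hpi : Real.sqrt (2 * Real.pi) ≤ 3 := by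
    rw [Real.sqrt_le_left (by norm_num)]
    linarith [Real.pi_lt_four, Real.pi_lt_d2]
  have hpi0 : 0 < Real.sqrt (2 * Real.pi) := by have := Real.pi_pos; positivity
  have he : (1 : ℝ) / 9 ≤ Real.exp (-2) := by
    rw [Real.exp_neg, ← one_div]
    refine one_div_le_one_div_of_le (Real.exp_pos _) ?_
    have h3 : Real.exp 2 = Real.exp 1 ^ 2 := by rw [← Real.exp_nat_mul]; norm_num
    have h4 := Real.exp_one_lt_d9
    have h5 := Real.exp_pos 1
    nlinarith
  have hlow : ∀ y ∈ Icc l (l + σ), 1 / 27 * σ⁻¹ ≤ gaussDensity σ (y - x) := by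
    intro y hy
    have h1 : |(y - x) / σ| ≤ 2 := by
      rw [abs_div, abs_of_pos hσ, div_le_iff₀ hσ]; exact hl y hy
    have h2 : ((y - x) / σ) ^ 2 ≤ 4 := by
      rw [← sq_abs]; nlinarith [abs_nonneg ((y - x) / σ)]
    calc (1 / 27 : ℝ) * σ⁻¹ = 3⁻¹ * σ⁻¹ * (1 / 9) := by ring
      _ ≤ (Real.sqrt (2 * Real.pi))⁻¹ * σ⁻¹ * Real.exp (-((y - x) / σ) ^ 2 / 2) := by
        gcongr
        exact he.trans (Real.exp_le_exp.2 (by linarith))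
      _ = _ := (gaussDensity_eq hσ _).symm
  have h := setIntegral_mono_on (μ := volume) (s := Icc l (l + σ)) (f := fun _ => 1 / 27 * σ⁻¹)
    (g := fun y => gaussDensity σ (y - x)) (integrableOn_const (by simp))
    ((integrable_gaussDensity σ).comp_sub_right x).integrableOn measurableSet_Icc hlow
  refine le_trans (le_of_eq ?_) h
  rw [setIntegral_const, Real.volume_real_Icc_of_le (by linarith)]
  simp only [smul_eq_mul]
  field_simp
  ring

theorem integral_lyapunov_le_of_large {σ x : ℝ} (hσ : 0 < σ) (hx : x < 0)
    (hlarge : 1001 ≤ |(x + 1) / σ|) :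
    ∫ y, lyapunov σ y ∂rwmKernelHat σ x ≤ 199 / 200 * lyapunov σ x := by
  obtain ⟨l, hl⟩ : ∃ l, ∀ y ∈ Icc l (l + σ), y < 0 ∧ |y - x| ≤ 2 * σ ∧
      |(y + 1) / σ| ≤ |(x + 1) / σ| - 1 := by
    rw [abs_div, abs_of_pos hσ, le_div_iff₀ hσ] at hlarge
    have key : ∀ y, |y + 1| ≤ |x + 1| - σ → |(y + 1) / σ| ≤ |(x + 1) / σ| - 1 := by
      intro y hy
      rw [abs_div, abs_div, abs_of_pos hσ, le_sub_iff_add_le, div_add_one hσ.ne']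
      gcongr
      linarith
    rcases le_total 0 (x + 1) with h | h
    · rw [abs_of_nonneg h] at hlarge key
      refine ⟨x - 2 * σ, fun y ⟨h1, h2⟩ => ⟨by linarith, ?_, key y ?_⟩⟩ <;>
        rw [abs_le] <;> constructor <;> linarith
    · rw [abs_of_nonpos h] at hlarge key
      refine ⟨x + σ, fun y ⟨h1, h2⟩ => ⟨by linarith, ?_, key y ?_⟩⟩ <;>
        rw [abs_le] <;> constructor <;> linarith
  set I := Icc l (l + σ) with hI
  have hi := (integrable_gaussDensity σ).comp_sub_right x
  have hfun : ∀ y, (1 / 500 - I.indicator (fun _ => (3 / 10 : ℝ)) y) * gaussDensity σ (y - x) =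
      1 / 500 * gaussDensity σ (y - x) -
        3 / 10 * I.indicator (fun y => gaussDensity σ (y - x)) y := by
    intro y
    by_cases hy : y ∈ I <;> simp [hy]; ring
  have hiI : Integrable (I.indicator fun y => gaussDensity σ (y - x)) :=
    hi.indicator measurableSet_Icc
  have hlt : 1 < |(x + 1) / σ| := by linarith
  have h := integral_lyapunov_le hσ hx (h := fun y => 1 / 500 - I.indicator (fun _ => 3 / 10) y)
    (by simp_rw [hfun]; exact (hi.const_mul _).sub (hiI.const_mul _)) ?_ ?_
  · refine h.trans (mul_le_mul_of_nonneg_right ?_ (lyapunov_pos σ x).le)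
    simp_rw [hfun]
    rw [integral_sub (hi.const_mul _) (hiI.const_mul _), integral_const_mul, integral_const_mul,
      integral_indicator measurableSet_Icc, integral_sub_right_eq_self (gaussDensity σ) x,
      integral_gaussDensity hσ]
    have := le_setIntegral_gaussDensity hσ fun y hy => (hl y hy).2.1
    linarith
  · intro y hy
    rw [indicator_of_notMem fun hyI => (hl y hyI).1.not_ge hy]
    norm_num
  · intro y hy
    by_cases hyI : y ∈ I
    · rw [indicator_of_mem hyI]
      have hin := (hl y hyI).2.2
      have hsq : ((y + 1) / σ) ^ 2 ≤ ((x + 1) / σ) ^ 2 := sq_le_sq.2 (by linarith)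
      have hp : 1 / 2 ≤ acceptProb σ x y := by
        refine le_trans (le_min (by norm_num) ?_) (le_acceptProb hσ hx.le y)
        have := Real.one_le_exp (x := (((x + 1) / σ) ^ 2 - ((y + 1) / σ) ^ 2) / 2) (by linarith)
        linarith
      refine (mul_exp_abs_sub_le_of_inward hin hp).trans ?_
      exact mul_le_mul_of_nonneg_right (by norm_num) (lyapunov_pos σ x).le
    · rw [indicator_of_notMem hyI, sub_zero]
      refine (mul_exp_abs_sub_le_of_large hlt (acceptProb_nonneg hσ x y)
        (acceptProb_le hσ x hy.le)).trans (mul_le_mul_of_nonneg_right ?_ (lyapunov_pos σ x).le)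
      rw [div_le_div_iff₀ (by linarith) (by norm_num)]
      linarith

theorem lyapunov_drift {σ x : ℝ} (hσ : 0 < σ) (hx : x < 0) :
    ∫ y, lyapunov σ y ∂rwmKernelHat σ x ≤ 199 / 200 * lyapunov σ x + 5 * Real.exp 1001 := by
  have hV := lyapunov_pos σ x
  rcases le_total 1001 |(x + 1) / σ| with h | h
  · have := integral_lyapunov_le_of_large hσ hx h
    have := Real.exp_pos 1001
    linarith
  · have h1 := integral_lyapunov_le_five hσ hx
    have h2 : lyapunov σ x ≤ Real.exp 1001 := Real.exp_le_exp.2 h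
    linarith

/-- On a sublevel set of the Lyapunov function, the restricted kernel dominates a multiple of
Lebesgue measure near the mode, with mass independent of `σ`. -/
theorem exists_minorization (R : ℝ) : ∃ ε : ℝ, 0 < ε ∧ ∀ σ : ℝ, 0 < σ → σ < 1 →
    ∃ ν : Measure ℝ, IsFiniteMeasure ν ∧ ε ≤ ν.real univ ∧
      ∀ x < 0, lyapunov σ x ≤ R → ν ≤ rwmKernelHat σ x := by
  have hpi : 0 < Real.sqrt (2 * Real.pi) := by have := Real.pi_pos; positivity
  set r := Real.log R with hr
  set ε := (1 / 2 * Real.exp (-1 / 2)) *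
    ((Real.sqrt (2 * Real.pi))⁻¹ * Real.exp (-(1 + r) ^ 2 / 2)) with hε
  have hε0 : 0 < ε := by positivity
  refine ⟨ε, hε0, fun σ hσ hσ1 => ?_⟩
  set I := Ico (-1) (-1 + σ) with hI
  refine ⟨volume.withDensity (I.indicator fun _ => ENNReal.ofReal (ε / σ)), ?_, ?_, ?_⟩
  · refine isFiniteMeasure_withDensity ?_
    rw [lintegral_indicator measurableSet_Ico]
    simp [ENNReal.mul_eq_top]
  · rw [measureReal_def, withDensity_apply _ MeasurableSet.univ, setLIntegral_univ,
      lintegral_indicator measurableSet_Ico, setLIntegral_const, Real.volume_Ico,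
      ← ENNReal.ofReal_mul (by positivity), ENNReal.toReal_ofReal (by simp; positivity)]
    refine le_of_eq ?_
    field_simp
    ring
  · intro x hx hxR
    obtain ⟨c, -, hP⟩ := exists_rwmKernelHat_eq hσ hx
    rw [hP]
    refine le_trans (withDensity_mono (ae_of_all _ fun y => ?_)) (Measure.le_add_right le_rfl)
    by_cases hy : y ∈ I
    · have hy0 : y < 0 := by linarith [hy.2]
      rw [indicator_of_mem hy, indicator_of_mem (mem_Iio.2 hy0)]
      refine ENNReal.ofReal_le_ofReal ?_
      have hu : |(x + 1) / σ| ≤ r := by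
        rw [hr, Real.le_log_iff_exp_le ((lyapunov_pos σ x).trans_le hxR)]
        exact hxR
      have hv0 : 0 ≤ (y + 1) / σ := div_nonneg (by linarith [hy.1]) hσ.le
      have hv1 : (y + 1) / σ ≤ 1 := (div_le_one hσ).2 (by linarith [hy.2])
      have hp : 1 / 2 * Real.exp (-1 / 2) ≤ acceptProb σ x y := by
        refine le_trans (le_min ?_ ?_) (le_acceptProb hσ hx.le y)
        · have : Real.exp (-1 / 2) ≤ 1 := Real.exp_le_one_iff.2 (by norm_num)
          linarith
        · have : Real.exp (-1 / 2) ≤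
              Real.exp ((((x + 1) / σ) ^ 2 - ((y + 1) / σ) ^ 2) / 2) :=
            Real.exp_le_exp.2 (by nlinarith [sq_nonneg ((x + 1) / σ)])
          linarith
      have hg : (Real.sqrt (2 * Real.pi))⁻¹ * σ⁻¹ * Real.exp (-(1 + r) ^ 2 / 2) ≤
          gaussDensity σ (y - x) := by
        rw [gaussDensity_eq hσ]
        have h1 : (y - x) / σ = (y + 1) / σ - (x + 1) / σ := by ring
        have h2 : |(y - x) / σ| ≤ |1 + r| := by
          rw [h1]
          refine (abs_sub _ _).trans ?_
          rw [abs_of_nonneg hv0]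
          exact (add_le_add hv1 hu).trans (le_abs_self _)
        have h3 := sq_le_sq.2 h2
        gcongr
      calc ε / σ = (1 / 2 * Real.exp (-1 / 2)) *
            ((Real.sqrt (2 * Real.pi))⁻¹ * σ⁻¹ * Real.exp (-(1 + r) ^ 2 / 2)) := by
            rw [hε]; ring
        _ ≤ acceptProb σ x y * gaussDensity σ (y - x) :=
            mul_le_mul hp hg (by positivity) (acceptProb_nonneg hσ x y)
    · rw [indicator_of_notMem hy]
      exact zero_le

/-- Geometric ergodicity of the restricted kernels, uniformly in the step size. -/
theorem exists_geometric_ergodicity : ∃ a β : ℝ, 0 < a ∧ a < 1 ∧ 0 < β ∧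
    ∀ σ : ℝ, 0 < σ → σ < 1 → ∀ (n : ℕ) (B : Set ℝ), MeasurableSet B → ∀ x < 0, ∀ y < 0,
      |(kiter (rwmKernelHat σ) n x B).toReal - (kiter (rwmKernelHat σ) n y B).toReal| ≤
        a ^ n * (2 + β * (lyapunov σ x + lyapunov σ y)) := by
  obtain ⟨ε, hε, hmin⟩ := exists_minorization (4 * (5 * Real.exp 1001) / (1 - 199 / 200))
  obtain ⟨a, β, ha0, ha1, hβ, h⟩ := exists_contraction (α := ℝ) (γ := 199 / 200)
    (K := 5 * Real.exp 1001) (ε := ε) (by norm_num) (by norm_num) (by positivity) hε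
  refine ⟨a, β, ha0, ha1, hβ, fun σ hσ hσ1 n B hB => ?_⟩
  obtain ⟨ν, hνf, hν, hνle⟩ := hmin σ hσ hσ1
  have hprob := isProbabilityMeasure_rwmKernelHat hσ
  exact abs_sub_kiter_le (S := Iio 0) (measurable_rwmKernelHat hσ)
    (fun x => (lyapunov_pos σ x).le) ha0.le hβ.le
    (h (rwmKernelHat σ) (Iio 0) (lyapunov σ) ν hprob (fun x hx => ae_rwmKernelHat_neg σ hx)
      (fun x => (lyapunov_pos σ x).le) (fun x hx => integrable_lyapunov hσ hx)
      (fun x hx => lyapunov_drift hσ hx) hν hνf hνle) hB n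

theorem lyapunov_le {σ x : ℝ} (hσ : 0 < σ) (hσ1 : σ < 1)
    (hx : x ∈ Ioo (-(1 / σ ^ 11)) 0) : lyapunov σ x ≤ Real.exp (1 / σ ^ 12) := by
  refine Real.exp_le_exp.2 ?_
  have h1 : 1 ≤ 1 / σ ^ 11 := by
    rw [le_div_iff₀ (by positivity), one_mul]
    exact pow_le_one₀ hσ.le hσ1.le
  have h2 : |x + 1| ≤ 1 / σ ^ 11 := abs_le.2 ⟨by linarith [hx.1], by linarith [hx.2]⟩
  rw [abs_div, abs_of_pos hσ]
  calc |x + 1| / σ ≤ 1 / σ ^ 11 / σ := by gcongr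
    _ = 1 / σ ^ 12 := by field_simp

end Lyapunov

/-- Crude coupling estimate: for `T > A₁ σ^{-a₁}`, the laws `K̂_σ^T(x,·)` and `K̂_σ^T(y,·)`
are within `A₁ e^{-a₁/σ}` in total variation, uniformly over `x, y ∈ (-σ^{-11}, -δ)`. -/
theorem stmt12 (δ : ℝ) (hδ0 : 0 < δ) (hδ : δ < 1 / 20) :
    ∃ a A : ℝ, 0 < a ∧ 0 < A ∧ ∃ σ₀ : ℝ, 0 < σ₀ ∧
      ∀ σ : ℝ, 0 < σ → σ < σ₀ →
        ∀ T : ℕ, A * σ ^ (-a) < (T : ℝ) →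
          ∀ x ∈ Set.Ioo (-(1 / σ ^ 11)) (-δ), ∀ y ∈ Set.Ioo (-(1 / σ ^ 11)) (-δ),
            ∀ B : Set ℝ, MeasurableSet B →
              |(kiter (rwmKernelHat σ) T x B).toReal - (kiter (rwmKernelHat σ) T y B).toReal|
                ≤ A * Real.exp (-a / σ) := by
  obtain ⟨a, β, ha0, ha1, hβ, h⟩ := exists_geometric_ergodicity
  have hlog : 0 < -Real.log a := neg_pos.2 (Real.log_neg ha0 ha1)
  set A := max (14 / -Real.log a) (2 + 2 * β) with hA
  have hA0 : 0 < A := lt_max_of_lt_right (by positivity)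
  refine ⟨13, A, by norm_num, hA0, 1, one_pos, fun σ hσ hσ1 T hT x hx y hy B hB => ?_⟩
  have hrpow : σ ^ (-13 : ℝ) = 1 / σ ^ 13 := by
    rw [Real.rpow_neg hσ.le, one_div]
    norm_cast
  rw [hrpow] at hT
  have hx' : x ∈ Ioo (-(1 / σ ^ 11)) 0 := ⟨hx.1, hx.2.trans (neg_lt_zero.2 hδ0)⟩
  have hy' : y ∈ Ioo (-(1 / σ ^ 11)) 0 := ⟨hy.1, hy.2.trans (neg_lt_zero.2 hδ0)⟩
  have hpow : ∀ {m n : ℕ}, m ≤ n → 1 / σ ^ m ≤ 1 / σ ^ n := fun hmn =>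
    one_div_le_one_div_of_le (by positivity) (pow_le_pow_of_le_one hσ.le hσ1.le hmn)
  have hT' : 14 * (1 / σ ^ 13) ≤ T * -Real.log a := by
    rw [← div_le_iff₀ hlog, mul_div_right_comm]
    exact (mul_le_mul_of_nonneg_right (le_max_left _ _) (by positivity)).trans hT.le
  have haT : a ^ T = Real.exp (-(T * -Real.log a)) := by
    rw [mul_neg, neg_neg, Real.exp_nat_mul, Real.exp_log ha0]
  have hV1 : 1 ≤ Real.exp (1 / σ ^ 12) := Real.one_le_exp (by positivity)
  refine (h σ hσ hσ1 T B hB x hx'.2 y hy'.2).trans ?_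
  calc a ^ T * (2 + β * (lyapunov σ x + lyapunov σ y))
      ≤ a ^ T * ((2 + 2 * β) * Real.exp (1 / σ ^ 12)) := by
        gcongr
        nlinarith [lyapunov_le hσ hσ1 hx', lyapunov_le hσ hσ1 hy']
    _ ≤ a ^ T * (A * Real.exp (1 / σ ^ 12)) := by
        gcongr
        exact le_max_right _ _
    _ = A * Real.exp (-(T * -Real.log a) + 1 / σ ^ 12) := by rw [haT, Real.exp_add]; ring
    _ ≤ A * Real.exp (-13 / σ) := by
        gcongr
        have h1 : 1 / σ ≤ 1 / σ ^ 13 := by simpa using hpow (m := 1) (n := 13) (by norm_num)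
        have h2 := hpow (m := 12) (n := 13) (by norm_num)
        rw [neg_div, div_eq_mul_one_div 13 σ]
        linarith
end

section
/- Fix 0 < δ < 1/20. There exist a constant C₃ > 0 independent of σ and σ₀ > 0 such that for all 0 < σ < σ₀: inf over x ∈ (−δ,0) of P[Y_{ψ_x} ≤ −δ] ≥ C₃·σ; that is, with probability at least C₃σ the Gaussian random walk exits the interval (−δ,0) through its left endpoint. -/
open MeasureTheory Filter Set

/-- `P` is the law on trajectory space (as produced by the Ionescu–Tulcea construction)
of the Markov chain with transition kernel `κ` started at `x`: a probability measure
with `X 0 = x` a.s. such that, conditionally on the first `n+1` coordinates,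
`X (n+1)` has law `κ (X n)`. -/
def IsMarkovChainLaw {α : Type*} [MeasurableSpace α] (κ : α → Measure α) (x : α)
    (P : Measure (ℕ → α)) : Prop :=
  IsProbabilityMeasure P ∧ P {ω | ω 0 = x} = 1 ∧
  ∀ (n : ℕ) (A : Set (ℕ → α)),
    MeasurableSet[MeasurableSpace.comap (fun ω (i : Fin (n + 1)) => ω i.1) inferInstance] A →
    ∀ B : Set α, MeasurableSet B →
      P (A ∩ {ω | ω (n + 1) ∈ B}) = ∫⁻ ω in A, κ (ω n) B ∂P

/-- Transition kernel of the Gaussian random walk `Y_{t+1} = Y_t + N(0,σ²)`. -/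
noncomputable def rwKernel (σ : ℝ) (y : ℝ) : Measure ℝ :=
  (gaussMeasure σ).map fun z => y + z

open ProbabilityTheory
open scoped ENNReal NNReal Topology

section MarkovChain

variable {α : Type*}

/-- Trajectories that stay in `I` up to and including time `n`. -/
def aliveSet (I : Set α) (n : ℕ) : Set (ℕ → α) :=
  {ω | ∀ s < n + 1, ω s ∈ I}

/-- Trajectories that by time `n` have entered `L`, having stayed in `I` before. -/
def exitSet (I L : Set α) (n : ℕ) : Set (ℕ → α) :=
  {ω | ∃ t < n + 1, (∀ s < t, ω s ∈ I) ∧ ω t ∈ L}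

lemma aliveSet_succ (I : Set α) (n : ℕ) :
    aliveSet I (n + 1) = aliveSet I n ∩ {ω | ω (n + 1) ∈ I} := by
  ext ω
  simp only [aliveSet, mem_ofPred_eq, mem_inter_iff]
  exact Nat.forall_lt_succ_right

variable [MeasurableSpace α]

lemma measurableSet_aliveSet_comap {I : Set α} (hI : MeasurableSet I) (n : ℕ) :
    MeasurableSet[MeasurableSpace.comap (fun (ω : ℕ → α) (i : Fin (n + 1)) => ω i.1)
      inferInstance] (aliveSet I n) := by
  refine ⟨{v | ∀ i, v i ∈ I}, ?_, ?_⟩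
  · rw [ofPred_forall]
    exact MeasurableSet.iInter fun i => measurable_pi_apply i hI
  · ext ω
    exact ⟨fun h s hs => h ⟨s, hs⟩, fun h i => h i.1 i.2⟩

lemma measurableSet_aliveSet {I : Set α} (hI : MeasurableSet I) (n : ℕ) :
    MeasurableSet (aliveSet I n) := by
  have hm : Measurable (fun (ω : ℕ → α) (i : Fin (n + 1)) => ω i.1) := by fun_prop
  exact hm.comap_le _ (measurableSet_aliveSet_comap hI n)

lemma IsMarkovChainLaw.setLIntegral_succ {κ : α → Measure α} (hκ : Measurable κ) {x : α}
    {P : Measure (ℕ → α)} (hP : IsMarkovChainLaw κ x P) {n : ℕ} {A : Set (ℕ → α)}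
    (hA : MeasurableSet[MeasurableSpace.comap (fun (ω : ℕ → α) (i : Fin (n + 1)) => ω i.1)
      inferInstance] A) {f : α → ℝ≥0∞} (hf : Measurable f) :
    ∫⁻ ω in A, f (ω (n + 1)) ∂P = ∫⁻ ω in A, ∫⁻ y, f y ∂κ (ω n) ∂P := by
  have hκn : Measurable fun ω : ℕ → α => κ (ω n) := hκ.comp (measurable_pi_apply n)
  have hm : Measurable fun ω : ℕ → α => ω (n + 1) := measurable_pi_apply (n + 1)
  have key : (P.restrict A).map (fun ω => ω (n + 1)) =
      (P.restrict A).bind fun ω => κ (ω n) := by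
    ext B hB
    rw [Measure.map_apply hm hB, Measure.bind_apply hB hκn.aemeasurable,
      Measure.restrict_apply (hm hB), inter_comm]
    exact hP.2.2 n A hA B hB
  rw [← lintegral_map hf hm, key, Measure.lintegral_bind hκn.aemeasurable hf.aemeasurable]

lemma IsMarkovChainLaw.measure_aliveSet_le {κ : α → Measure α} {x : α}
    {P : Measure (ℕ → α)} (hP : IsMarkovChainLaw κ x P) {I : Set α} (hI : MeasurableSet I)
    {q : ℝ≥0∞} (hq : ∀ y ∈ I, κ y I ≤ q) (n : ℕ) : P (aliveSet I n) ≤ q ^ n := by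
  have := hP.1
  induction n with
  | zero => simpa using prob_le_one
  | succ n ih =>
    rw [aliveSet_succ, hP.2.2 n _ (measurableSet_aliveSet_comap hI n) I hI]
    calc ∫⁻ ω in aliveSet I n, κ (ω n) I ∂P
        ≤ ∫⁻ _ in aliveSet I n, q ∂P :=
          setLIntegral_mono' (measurableSet_aliveSet hI n) fun ω hω => hq _ (hω n n.lt_succ_self)
      _ = q * P (aliveSet I n) := by simp
      _ ≤ q * q ^ n := by gcongr
      _ = q ^ (n + 1) := (pow_succ' q n).symm

lemma IsMarkovChainLaw.measure_exitSet_step {κ : α → Measure α} (hκ : Measurable κ) {x : α}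
    {P : Measure (ℕ → α)} (hP : IsMarkovChainLaw κ x P) {I L : Set α} (hI : MeasurableSet I)
    (hL : MeasurableSet L) (hIL : Disjoint I L) {h : α → ℝ≥0∞} (hh : Measurable h)
    (hle : ∀ y, h y ≤ L.indicator 1 y + I.indicator h y) (n : ℕ) :
    P (exitSet I L n) + ∫⁻ ω in aliveSet I n, ∫⁻ y, h y ∂κ (ω n) ∂P ≤
      P (exitSet I L (n + 1)) + ∫⁻ ω in aliveSet I (n + 1), h (ω (n + 1)) ∂P := by
  have hm : Measurable fun ω : ℕ → α => ω (n + 1) := measurable_pi_apply (n + 1)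
  have hA := measurableSet_aliveSet hI n
  have hsplit : ∫⁻ ω in aliveSet I n, h (ω (n + 1)) ∂P ≤
      P (aliveSet I n ∩ {ω | ω (n + 1) ∈ L}) +
        ∫⁻ ω in aliveSet I (n + 1), h (ω (n + 1)) ∂P := by
    calc ∫⁻ ω in aliveSet I n, h (ω (n + 1)) ∂P
        ≤ ∫⁻ ω in aliveSet I n, (L.indicator 1 (ω (n + 1)) + I.indicator h (ω (n + 1))) ∂P :=
          lintegral_mono fun ω => hle _
      _ = ∫⁻ ω in aliveSet I n, {ω : ℕ → α | ω (n + 1) ∈ L}.indicator 1 ω ∂P +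
          ∫⁻ ω in aliveSet I n,
            {ω : ℕ → α | ω (n + 1) ∈ I}.indicator (fun ω => h (ω (n + 1))) ω ∂P :=
          lintegral_add_left ((measurable_one.indicator hL).comp hm) _
      _ = _ := by
          have hmL : MeasurableSet {ω : ℕ → α | ω (n + 1) ∈ L} := hm hL
          have hmI : MeasurableSet {ω : ℕ → α | ω (n + 1) ∈ I} := hm hI
          rw [lintegral_indicator_one hmL, Measure.restrict_apply hmL,
            lintegral_indicator hmI, Measure.restrict_restrict hmI, aliveSet_succ,
            inter_comm, inter_comm (aliveSet I n) {ω | ω (n + 1) ∈ I}]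
  have hdisj : Disjoint (exitSet I L n) (aliveSet I n ∩ {ω | ω (n + 1) ∈ L}) := by
    rw [Set.disjoint_left]
    rintro ω ⟨t, ht, -, htL⟩ ⟨hal, -⟩
    exact Set.disjoint_left.1 hIL (hal t ht) htL
  have hsub : exitSet I L n ∪ (aliveSet I n ∩ {ω | ω (n + 1) ∈ L}) ⊆ exitSet I L (n + 1) := by
    rintro ω (⟨t, ht, h1, h2⟩ | ⟨h1, h2⟩)
    · exact ⟨t, ht.trans (Nat.lt_succ_self _), h1, h2⟩
    · exact ⟨n + 1, Nat.lt_succ_self _, h1, h2⟩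
  rw [← hP.setLIntegral_succ hκ (measurableSet_aliveSet_comap hI n) hh]
  calc _ ≤ P (exitSet I L n) + (P (aliveSet I n ∩ {ω | ω (n + 1) ∈ L}) +
        ∫⁻ ω in aliveSet I (n + 1), h (ω (n + 1)) ∂P) := by gcongr
    _ = P (exitSet I L n ∪ (aliveSet I n ∩ {ω | ω (n + 1) ∈ L})) +
        ∫⁻ ω in aliveSet I (n + 1), h (ω (n + 1)) ∂P := by
        rw [measure_union hdisj (hA.inter (hm hL)), add_assoc]
    _ ≤ _ := by gcongr

/-- A function `h ≤ 1`, supported in `I ∪ L` and subharmonic on `I`, gives a lower bound for the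
probability that the chain started in `I` enters `L` when it leaves `I`. -/
lemma IsMarkovChainLaw.lintegral_le_measure_exit [MeasurableSingletonClass α] {κ : α → Measure α} (hκ : Measurable κ) {x : α}
    {P : Measure (ℕ → α)} (hP : IsMarkovChainLaw κ x P) {I L : Set α} (hI : MeasurableSet I)
    (hL : MeasurableSet L) (hIL : Disjoint I L) (hx : x ∈ I) {h : α → ℝ≥0∞} (hh : Measurable h)
    (hle : ∀ y, h y ≤ L.indicator 1 y + I.indicator h y) (h1 : ∀ y ∈ I, h y ≤ 1)
    (hsub : ∀ y ∈ I, h y ≤ ∫⁻ z, h z ∂κ y) {q : ℝ≥0∞} (hq1 : q < 1) (hq : ∀ y ∈ I, κ y I ≤ q) :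
    ∫⁻ z, h z ∂κ x ≤ P {ω | ∃ t : ℕ, (∀ s < t, ω s ∈ I) ∧ ω t ∈ L} := by
  have hprob := hP.1
  have hx0 : MeasurableSet {ω : ℕ → α | ω 0 = x} :=
    (measurable_pi_apply (X := fun _ : ℕ => α) 0) (measurableSet_singleton x)
  have hae : ∀ᵐ ω ∂P, ω 0 = x := (mem_ae_iff_prob_eq_one hx0).2 hP.2.1
  have halive : aliveSet I 0 =ᵐ[P] univ := by
    rw [eventuallyEq_univ]
    filter_upwards [hae] with ω hω s hs
    obtain rfl : s = 0 := by omega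
    rwa [hω]
  have hstart : ∫⁻ z, h z ∂κ x ≤ P (exitSet I L 1) + ∫⁻ ω in aliveSet I 1, h (ω 1) ∂P := by
    refine le_trans ?_ (hP.measure_exitSet_step hκ hI hL hIL hh hle 0)
    refine le_trans (le_of_eq ?_) le_add_self
    rw [setLIntegral_congr halive, Measure.restrict_univ,
      lintegral_congr_ae (μ := P) (g := fun _ => ∫⁻ z, h z ∂κ x)]
    · simp
    · filter_upwards [hae] with ω hω
      rw [hω]
  have hV : ∀ n, ∫⁻ z, h z ∂κ x ≤
      P (exitSet I L (n + 1)) + ∫⁻ ω in aliveSet I (n + 1), h (ω (n + 1)) ∂P := by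
    intro n
    induction n with
    | zero => exact hstart
    | succ n ih =>
      refine ih.trans (le_trans ?_ (hP.measure_exitSet_step hκ hI hL hIL hh hle (n + 1)))
      refine add_le_add le_rfl ?_
      exact setLIntegral_mono' (measurableSet_aliveSet hI _)
        fun ω hω => hsub _ (hω _ (Nat.lt_succ_self _))
  set E := {ω : ℕ → α | ∃ t : ℕ, (∀ s < t, ω s ∈ I) ∧ ω t ∈ L}
  have hbound : ∀ n, ∫⁻ z, h z ∂κ x ≤ P E + q ^ (n + 1) := by
    intro n
    refine (hV n).trans (add_le_add (measure_mono ?_) ?_)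
    · rintro ω ⟨t, -, ht⟩
      exact ⟨t, ht⟩
    · calc ∫⁻ ω in aliveSet I (n + 1), h (ω (n + 1)) ∂P
          ≤ ∫⁻ _ in aliveSet I (n + 1), 1 ∂P :=
            setLIntegral_mono' (measurableSet_aliveSet hI _)
              fun ω hω => h1 _ (hω _ (Nat.lt_succ_self _))
        _ = P (aliveSet I (n + 1)) := by simp
        _ ≤ q ^ (n + 1) := hP.measure_aliveSet_le hI hq _
  have hlim : Tendsto (fun n : ℕ => P E + q ^ (n + 1)) atTop (𝓝 (P E + 0)) :=
    tendsto_const_nhds.add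
      ((tendsto_add_atTop_iff_nat 1).2 (ENNReal.tendsto_pow_atTop_nhds_zero_of_lt_one hq1))
  rw [add_zero] at hlim
  exact ge_of_tendsto' hlim hbound

end MarkovChain

lemma gaussMeasure_eq {σ : ℝ} (hσ : 0 < σ) :
    gaussMeasure σ = gaussianReal 0 (.mk (σ ^ 2) (sq_nonneg σ)) := by
  have hv : NNReal.mk (σ ^ 2) (sq_nonneg σ) ≠ 0 := by
    rw [Ne, ← NNReal.coe_eq_zero]
    exact (pow_pos hσ 2).ne'
  rw [gaussMeasure, gaussianReal_of_var_ne_zero _ hv]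
  congr 1
  ext z
  simp [gaussDensity, gaussianPDF, gaussianPDFReal]

lemma measurable_rwKernel {σ : ℝ} [SFinite (gaussMeasure σ)] : Measurable (rwKernel σ) := by
  refine Measure.measurable_of_measurable_coe _ fun B hB => ?_
  have : (fun y => rwKernel σ y B) =
      fun y => gaussMeasure σ (Prod.mk y ⁻¹' ((fun p : ℝ × ℝ => p.1 + p.2) ⁻¹' B)) := by
    ext y
    rw [rwKernel, Measure.map_apply (by fun_prop) hB]
    rfl
  rw [this]
  exact measurable_measure_prodMk_left ((measurable_fst.add measurable_snd) hB)

lemma integral_eq_zero_of_odd {μ : Measure ℝ} (hμ : μ.map (fun x => -x) = μ) {T : ℝ → ℝ}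
    (hT : Measurable T) (hodd : ∀ u, T (-u) = -T u) : ∫ u, T u ∂μ = 0 := by
  have h : ∫ u, T u ∂μ = -∫ u, T u ∂μ := by
    conv_lhs => rw [← hμ]
    rw [integral_map measurable_neg.aemeasurable hT.aestronglyMeasurable]
    simp_rw [hodd]
    rw [integral_neg]
  linarith

/-- The odd truncation of the identity at level `δ`. -/
noncomputable def clamp (δ u : ℝ) : ℝ := max (-δ) (min u δ)

lemma clamp_neg {δ : ℝ} (hδ : 0 < δ) (u : ℝ) : clamp δ (-u) = -clamp δ u := by
  unfold clamp
  grind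

/-- The value `1` to the left of the interval `(-δ,0)`, linear inside it, zero to the right. -/
noncomputable def barrier (δ y : ℝ) : ℝ :=
  if y ≤ -δ then 1 else max (-y) 0 / (2 * δ)

lemma measurable_barrier (δ : ℝ) : Measurable (barrier δ) :=
  Measurable.ite measurableSet_Iic measurable_const (by fun_prop)

lemma barrier_nonneg {δ : ℝ} (hδ : 0 < δ) (y : ℝ) : 0 ≤ barrier δ y := by
  unfold barrier
  split_ifs <;> positivity

lemma barrier_le_one {δ : ℝ} (hδ : 0 < δ) (y : ℝ) : barrier δ y ≤ 1 := by
  unfold barrier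
  split_ifs
  · rfl
  · rw [div_le_one (by positivity)]
    grind

lemma barrier_ge {δ x : ℝ} (hx : x ∈ Ioo (-δ) 0) (u : ℝ) :
    barrier δ x - clamp δ u / (2 * δ) ≤ barrier δ (x + u) := by
  obtain ⟨h1, h2⟩ := hx
  have hδ : 0 < 2 * δ := by linarith
  unfold barrier clamp
  rw [if_neg (not_le.2 h1), ← sub_div]
  split_ifs with h
  · rw [div_le_one hδ]
    grind
  · rw [div_le_div_iff_of_pos_right hδ]
    grind

lemma barrier_le_lintegral {μ : Measure ℝ} [IsProbabilityMeasure μ]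
    (hμ : μ.map (fun x => -x) = μ) {δ x : ℝ} (hx : x ∈ Ioo (-δ) 0) :
    ENNReal.ofReal (barrier δ x) ≤ ∫⁻ u, ENNReal.ofReal (barrier δ (x + u)) ∂μ := by
  have hδ : 0 < δ := by linarith [hx.1, hx.2]
  have hTm : Measurable (clamp δ) := by unfold clamp; fun_prop
  have hTi : Integrable (clamp δ) μ := by
    refine Integrable.of_bound hTm.aestronglyMeasurable δ (ae_of_all _ fun u => ?_)
    rw [Real.norm_eq_abs, abs_le]
    unfold clamp
    grind
  have hbm : Measurable fun u => barrier δ (x + u) :=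
    (measurable_barrier δ).comp (measurable_const_add x)
  have hbi : Integrable (fun u => barrier δ (x + u)) μ := by
    refine Integrable.of_bound hbm.aestronglyMeasurable 1 (ae_of_all _ fun u => ?_)
    rw [Real.norm_eq_abs, abs_of_nonneg (barrier_nonneg hδ _)]
    exact barrier_le_one hδ _
  rw [← ofReal_integral_eq_lintegral_ofReal hbi (ae_of_all _ fun u => barrier_nonneg hδ _)]
  refine ENNReal.ofReal_le_ofReal ?_
  calc barrier δ x = ∫ u, (barrier δ x - clamp δ u / (2 * δ)) ∂μ := by
        rw [integral_sub (integrable_const _) (hTi.div_const _), integral_div,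
          integral_eq_zero_of_odd hμ hTm (clamp_neg hδ)]
        simp
    _ ≤ _ := integral_mono ((integrable_const _).sub (hTi.div_const _)) hbi (barrier_ge hx)

lemma gaussMeasure_Iic_neg {σ : ℝ} (hσ : 0 < σ) :
    gaussMeasure σ (Iic (-σ)) = gaussianReal 0 1 (Iic (-1)) := by
  have h := gaussianReal_map_const_mul (μ := 0) (v := 1) σ
  rw [mul_zero, mul_one] at h
  rw [gaussMeasure_eq hσ, ← h, Measure.map_apply (by fun_prop) measurableSet_Iic]
  congr 1
  ext z
  simp only [mem_preimage, mem_Iic]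
  constructor <;> intro hz <;> nlinarith

lemma mul_le_lintegral_barrier {μ : Measure ℝ} {δ σ x : ℝ}
    (hσ : σ ≤ 2 * δ) (hx : x ∈ Ioo (-δ) 0) :
    ENNReal.ofReal (σ / (2 * δ)) * μ (Iic (-σ)) ≤
      ∫⁻ u, ENNReal.ofReal (barrier δ (x + u)) ∂μ := by
  rw [← setLIntegral_const]
  refine (setLIntegral_mono' measurableSet_Iic fun u hu => ?_).trans (setLIntegral_le_lintegral _ _)
  have hδ : 0 < 2 * δ := by linarith [hx.1, hx.2]
  refine ENNReal.ofReal_le_ofReal ?_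
  unfold barrier
  split_ifs with h
  · rwa [div_le_one hδ]
  · rw [div_le_div_iff_of_pos_right hδ]
    exact le_max_of_le_left (by linarith [hx.2, mem_Iic.1 hu])

lemma gaussianReal_pos_of_volume_pos {m : ℝ} {v : ℝ≥0} (hv : v ≠ 0) {s : Set ℝ}
    (hs : 0 < volume s) : 0 < gaussianReal m v s :=
  pos_iff_ne_zero.2 fun h => hs.ne' (gaussianReal_absolutelyContinuous' m hv h)

/-- With probability at least `C₃ σ`, the Gaussian random walk started anywhere in
`(-δ,0)` exits the interval `(-δ,0)` through its left endpoint. -/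
theorem stmt17 (δ : ℝ) (hδ0 : 0 < δ) (hδ : δ < 1 / 20) :
    ∃ C : ℝ, 0 < C ∧ ∃ σ₀ : ℝ, 0 < σ₀ ∧
      ∀ σ : ℝ, 0 < σ → σ < σ₀ →
        ∀ x ∈ Set.Ioo (-δ) (0 : ℝ), ∀ P : Measure (ℕ → ℝ),
          IsMarkovChainLaw (rwKernel σ) x P →
            C * σ ≤ (P {ω | ∃ t : ℕ, (∀ s < t, ω s ∈ Set.Ioo (-δ) 0) ∧ ω t ≤ -δ}).toReal := by
  set p := gaussianReal 0 1 (Iic (-1)) with hp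
  have hp0 : 0 < p := gaussianReal_pos_of_volume_pos one_ne_zero (by simp)
  have hptop : p ≠ ∞ := measure_ne_top _ _
  refine ⟨p.toReal / (2 * δ), div_pos (ENNReal.toReal_pos hp0.ne' hptop) (by positivity),
    2 * δ, by positivity, fun σ hσ hσδ x hx P hP => ?_⟩
  have hv : NNReal.mk (σ ^ 2) (sq_nonneg σ) ≠ 0 := by
    rw [Ne, ← NNReal.coe_eq_zero]
    exact (pow_pos hσ 2).ne'
  have hg := gaussMeasure_eq hσ
  have hprob : IsProbabilityMeasure (gaussMeasure σ) := by rw [hg]; infer_instance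
  have hsymm : (gaussMeasure σ).map (fun x => -x) = gaussMeasure σ := by
    rw [hg, gaussianReal_map_neg, neg_zero]
  have hbm : Measurable fun y => ENNReal.ofReal (barrier δ y) :=
    (measurable_barrier δ).ennreal_ofReal
  have hker : ∀ y, ∫⁻ z, ENNReal.ofReal (barrier δ z) ∂rwKernel σ y =
      ∫⁻ u, ENNReal.ofReal (barrier δ (y + u)) ∂gaussMeasure σ := fun y => by
    rw [rwKernel, lintegral_map hbm (measurable_const_add y)]
  have hq1 : gaussMeasure σ (Iio δ) < 1 := by
    have h : 0 < gaussMeasure σ (Ici δ) := by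
      rw [hg]
      exact gaussianReal_pos_of_volume_pos hv (by simp)
    rw [← compl_Ici, prob_compl_eq_one_sub measurableSet_Ici]
    exact ENNReal.sub_lt_self ENNReal.one_ne_top one_ne_zero h.ne'
  have hprobP := hP.1
  have main := hP.lintegral_le_measure_exit measurable_rwKernel (I := Ioo (-δ) 0) (L := Iic (-δ))
    measurableSet_Ioo measurableSet_Iic
    (Set.disjoint_left.2 fun y hy hy' => not_le.2 hy.1 hy') hx hbm
    (fun y => by
      by_cases h1 : y ≤ -δ
      · simp [barrier, h1]
      · by_cases h2 : y < 0
        · have h3 : y ∈ Ioo (-δ) 0 := ⟨not_le.1 h1, h2⟩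
          simp [indicator_of_mem h3]
        · have h3 : max (-y) 0 = 0 := max_eq_right (by linarith)
          simp [barrier, h1, h3])
    (fun y _ => ENNReal.ofReal_le_one.2 (barrier_le_one hδ0 y))
    (fun y hy => by
      rw [hker]
      exact barrier_le_lintegral hsymm hy)
    hq1
    (fun y hy => by
      rw [rwKernel, Measure.map_apply (measurable_const_add y) measurableSet_Ioo]
      refine measure_mono fun z hz => ?_
      have := hz.2
      rw [mem_Iio]
      linarith [hy.1])
  rw [hker] at main
  have hfin := (mul_le_lintegral_barrier (μ := gaussMeasure σ) hσδ.le hx).trans main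
  rw [gaussMeasure_Iic_neg hσ, ← hp] at hfin
  have hreal := ENNReal.toReal_mono (measure_ne_top P _) hfin
  rw [ENNReal.toReal_mul, ENNReal.toReal_ofReal (by positivity)] at hreal
  calc p.toReal / (2 * δ) * σ = σ / (2 * δ) * p.toReal := by ring
    _ ≤ _ := hreal
end
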